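/- Let k ≥ 1 and let β ∈ ℝ^{k+1} satisfy β_1 ≤ β_2 ≤ ⋯ ≤ β_{k+1}. Define the interlacing region I(β) = {α ∈ ℝ^k : β_1 ≤ α_1 ≤ β_2 ≤ α_2 ≤ ⋯ ≤ α_k ≤ β_{k+1}}. Then ∫_{I(β)} Δ(α_1, …, α_k) dα = (1/k!) · Δ(β_1, …, β_{k+1}), where Δ(w_1, …, w_r) := ∏_{i>j}(w_i − w_j) is the Vandermonde determinant. -/

import Mathlib

open MeasureTheory

lemma prod_eq_det_vandermonde {n : ℕ} (v : Fin n → ℝ) :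
    ∏ p ∈ Finset.univ.filter (fun p : Fin n × Fin n => p.2 < p.1), (v p.1 - v p.2)
      = (Matrix.vandermonde v).det := by
  rw [Matrix.det_vandermonde, Finset.prod_filter, Fintype.prod_prod_type, Finset.prod_comm]
  refine Finset.prod_congr rfl fun i _ => ?_
  rw [← Finset.prod_filter]
  refine Finset.prod_congr ?_ fun _ _ => rfl
  ext j; simp

lemma det_diff {k : ℕ} (β : Fin (k + 1) → ℝ) :
    (Matrix.of fun i j : Fin k => β i.succ ^ (j.val + 1) - β i.castSucc ^ (j.val + 1)).det
      = (Matrix.vandermonde β).det := by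
  have h := Matrix.det_eq_of_forall_row_eq_smul_add_pred (A := Matrix.vandermonde β)
    (B := Matrix.of (fun i j : Fin (k + 1) =>
      (Fin.cases (β 0 ^ j.val) (fun i => β i.succ ^ j.val - β i.castSucc ^ j.val) i : ℝ)))
    (fun _ => 1) (by intro j; simp [Matrix.vandermonde_apply])
    (by intro i j; simp [Matrix.vandermonde_apply])
  rw [h, Matrix.det_succ_column_zero, Fin.sum_univ_succ]
  simp
  congr 1

theorem vandermonde_interlacing_integral (k : ℕ) (hk : 1 ≤ k)
    (β : Fin (k + 1) → ℝ) (hβ : Monotone β) :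
    (∫ α in {α : Fin k → ℝ | ∀ i : Fin k, β i.castSucc ≤ α i ∧ α i ≤ β i.succ},
        ∏ p ∈ Finset.univ.filter (fun p : Fin k × Fin k => p.2 < p.1), (α p.1 - α p.2))
      = (1 / (k.factorial : ℝ)) *
          ∏ p ∈ Finset.univ.filter (fun p : Fin (k + 1) × Fin (k + 1) => p.2 < p.1),
            (β p.1 - β p.2) := by
  have hset : {α : Fin k → ℝ | ∀ i : Fin k, β i.castSucc ≤ α i ∧ α i ≤ β i.succ}
      = Set.univ.pi (fun i : Fin k => Set.Icc (β i.castSucc) (β i.succ)) := by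
    ext α; simp only [Set.mem_pi, Set.mem_setOf_eq, Set.mem_univ, Set.mem_Icc, forall_const]
  rw [hset, volume_pi, Measure.restrict_pi_pi]
  simp_rw [prod_eq_det_vandermonde]
  rw [← det_diff β]
  have h1 : ∀ α : Fin k → ℝ, (Matrix.vandermonde α).det
      = ∑ σ : Equiv.Perm (Fin k), ((Equiv.Perm.sign σ : ℤ) : ℝ) * ∏ i, α i ^ (σ i).val := by
    intro α
    rw [← Matrix.det_transpose, Matrix.det_apply']
    rfl
  simp_rw [h1]
  rw [integral_finsetSum]
  · simp_rw [integral_const_mul]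
    have h2 : ∀ σ : Equiv.Perm (Fin k),
        ∫ α : Fin k → ℝ, ∏ i, α i ^ (σ i).val
          ∂(Measure.pi fun i : Fin k => volume.restrict (Set.Icc (β i.castSucc) (β i.succ)))
        = (1 / (k.factorial : ℝ)) *
          ∏ i, (β i.succ ^ ((σ i).val + 1) - β i.castSucc ^ ((σ i).val + 1)) := by
      intro σ
      rw [integral_fintype_prod_eq_prod (f := fun (i : Fin k) (x : ℝ) => x ^ (σ i).val)]
      have h3 : ∀ i : Fin k, ∫ x in Set.Icc (β i.castSucc) (β i.succ), x ^ (σ i).val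
          = (β i.succ ^ ((σ i).val + 1) - β i.castSucc ^ ((σ i).val + 1)) / ((σ i).val + 1 : ℝ) := by
        intro i
        rw [integral_Icc_eq_integral_Ioc, ← intervalIntegral.integral_of_le
          (hβ (Fin.castSucc_lt_succ).le), integral_pow]
      simp_rw [h3]
      rw [Finset.prod_div_distrib]
      have h4 : ∏ i : Fin k, ((σ i).val + 1 : ℝ) = k.factorial := by
        rw [Equiv.prod_comp σ (fun j : Fin k => (j.val + 1 : ℝ)),
          Fin.prod_univ_eq_prod_range (fun j => (j + 1 : ℝ)), ← Finset.prod_range_add_one_eq_factorial]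
        push_cast; rfl
      rw [h4]; ring
    simp_rw [h2]
    rw [← Matrix.det_transpose, Matrix.det_apply', Finset.mul_sum]
    refine Finset.sum_congr rfl fun σ _ => ?_
    simp only [Matrix.transpose_apply, Matrix.of_apply]
    ring
  · intro σ _
    refine Integrable.const_mul ?_ _
    refine Integrable.fintype_prod (f := fun (i : Fin k) (x : ℝ) => x ^ (σ i).val) fun i => ?_
    exact (continuous_pow _).continuousOn.integrableOn_Icc
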